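/- For all integers n ≥ 1 and k ≥ 0, ĉ_{n,k} = Σ_{i=0}^{n−1} Σ_{j=0}^{k} (n−1)_i · C(k,j) · ĉ_{n−1−i, k−j}, where (n−1)_i = (n−1)(n−2)⋯(n−i) is the falling factorial (with (n−1)_0 = 1) and C(k,j) denotes the binomial coefficient. -/

import Mathlib

/-- Unsigned Stirling numbers of the first kind:
`c(0,0)=1`, `c(n,m)=0` for `m>n` or (`n>0` and `m=0`), and `c(n+1,m)=n*c(n,m)+c(n,m-1)`. -/
def stirling1 : ℕ → ℕ → ℕ
  | 0, 0 => 1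
  | 0, _ + 1 => 0
  | _ + 1, 0 => 0
  | n + 1, m + 1 => n * stirling1 n (m + 1) + stirling1 n m

/-- Stirling numbers of the second kind:
`S(0,0)=1`, `S(n,m)=0` for `m>n` or (`n>0` and `m=0`), and `S(n+1,m)=m*S(n,m)+S(n,m-1)`. -/
def stirling2 : ℕ → ℕ → ℕ
  | 0, 0 => 1
  | 0, _ + 1 => 0
  | _ + 1, 0 => 0
  | n + 1, m + 1 => (m + 1) * stirling2 n (m + 1) + stirling2 n m

/-- Poly-Cauchy numbers of the second kind (negated upper index, unsigned):
`ĉ_{n,k} = Σ_{m=0}^n c(n,m)·(m+1)^k`. -/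
def polyCauchy (n k : ℕ) : ℕ := ∑ m ∈ Finset.range (n + 1), stirling1 n m * (m + 1) ^ k

theorem stirling1_eq_zero_of_lt : ∀ {n m : ℕ}, n < m → stirling1 n m = 0
  | 0, m + 1, _ => by simp [stirling1]
  | n + 1, m + 1, h => by
    have h' : n < m := Nat.lt_of_succ_lt_succ h
    simp [stirling1, stirling1_eq_zero_of_lt h', stirling1_eq_zero_of_lt (h'.trans m.lt_succ_self)]

theorem mul_stirling1_zero (n : ℕ) : n * stirling1 n 0 = 0 := by
  cases n <;> simp [stirling1]

theorem sum_stirling1_succ_mul (n : ℕ) (f : ℕ → ℕ) :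
    ∑ m ∈ Finset.range (n + 2), stirling1 (n + 1) m * f m =
      n * ∑ m ∈ Finset.range (n + 1), stirling1 n m * f m +
        ∑ m ∈ Finset.range (n + 1), stirling1 n m * f (m + 1) := by
  have h : n * ∑ m ∈ Finset.range (n + 1), stirling1 n m * f m =
      ∑ m ∈ Finset.range (n + 1), n * stirling1 n (m + 1) * f (m + 1) := by
    rw [Finset.sum_range_succ', Finset.sum_range_succ, mul_add, ← mul_assoc,
      mul_stirling1_zero, stirling1_eq_zero_of_lt n.lt_succ_self, Finset.mul_sum]
    simp [mul_assoc]
  rw [h, Finset.sum_range_succ', ← Finset.sum_add_distrib]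
  simp [stirling1, add_mul]

theorem sum_stirling1_succ_mul_eq_sum_descFactorial (n : ℕ) (f : ℕ → ℕ) :
    ∑ m ∈ Finset.range (n + 2), stirling1 (n + 1) m * f m =
      ∑ i ∈ Finset.range (n + 1), n.descFactorial i *
        ∑ m ∈ Finset.range (n - i + 1), stirling1 (n - i) m * f (m + 1) := by
  induction n with
  | zero => simp [sum_stirling1_succ_mul]
  | succ n ih =>
    rw [sum_stirling1_succ_mul, ih, Finset.mul_sum,
      Finset.sum_range_succ' fun i => (n + 1).descFactorial i * _]
    simp [Nat.succ_descFactorial_succ, -Nat.descFactorial_succ, mul_assoc]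

theorem sum_stirling1_mul_add_two_pow (n k : ℕ) :
    ∑ m ∈ Finset.range (n + 1), stirling1 n m * (m + 1 + 1) ^ k =
      ∑ j ∈ Finset.range (k + 1), k.choose j * polyCauchy n (k - j) := by
  simp only [polyCauchy, Finset.mul_sum]
  rw [Finset.sum_comm]
  refine Finset.sum_congr rfl fun m _ => ?_
  rw [add_comm (m + 1) 1, add_pow, Finset.mul_sum]
  refine Finset.sum_congr rfl fun j _ => ?_
  simp only [one_pow, Nat.cast_id]
  ring

theorem polyCauchy_recurrence' (n k : ℕ) (hn : 1 ≤ n) :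
    polyCauchy n k = ∑ i ∈ Finset.range n, ∑ j ∈ Finset.range (k + 1),
      Nat.descFactorial (n - 1) i * Nat.choose k j * polyCauchy (n - 1 - i) (k - j) := by
  obtain ⟨n, rfl⟩ := Nat.exists_eq_add_of_le' hn
  rw [polyCauchy, sum_stirling1_succ_mul_eq_sum_descFactorial n fun m => (m + 1) ^ k]
  simp only [sum_stirling1_mul_add_two_pow, Finset.mul_sum, Nat.add_sub_cancel, mul_assoc]
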